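/- Local uniform integrability of log of holomorphic functions under uniform convergence: let f_i be holomorphic functions on a neighborhood of the closed unit ball B ⊂ ℂⁿ, converging uniformly on B to a holomorphic function f_∞ ≢ 0 with sup_B |f_i| ≤ 1. Then ∫_B log|f_i| converges to ∫_B log|f_∞|; in particular ∫_B log|f_i| is uniformly bounded. -/

import Mathlib

open MeasureTheory

noncomputable instance (n : ℕ) : MeasurableSpace (EuclideanSpace ℂ (Fin n)) := borel _
instance (n : ℕ) : BorelSpace (EuclideanSpace ℂ (Fin n)) := ⟨rfl⟩

section

open MeasureTheory Set Filter Topology Metric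
open scoped ENNReal

noncomputable def logU (c : ℂ) : ℝ≥0∞ := if c = 0 then ⊤ else ENNReal.ofReal (-Real.log ‖c‖)

lemma logU_zero : logU 0 = ⊤ := by simp [logU]

lemma logU_of_ne {c : ℂ} (h : c ≠ 0) : logU c = ENNReal.ofReal (-Real.log ‖c‖) := by simp [logU, h]

lemma logU_toReal {c : ℂ} (h : ‖c‖ ≤ 1) : (logU c).toReal = -Real.log ‖c‖ := by
  by_cases hc : c = 0
  · simp [hc, logU_zero]
  · rw [logU_of_ne hc, ENNReal.toReal_ofReal]
    have := Real.log_nonpos (norm_nonneg c) h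
    linarith

lemma continuous_logU : Continuous logU := by
  rw [continuous_iff_continuousAt]
  intro c
  by_cases hc : c = 0
  · subst hc
    rw [← continuousWithinAt_compl_self]
    unfold ContinuousWithinAt
    rw [logU_zero]
    have h1 : Tendsto (fun c : ℂ => ENNReal.ofReal (-Real.log ‖c‖)) (𝓝[{0}ᶜ] 0) (𝓝 ⊤) := by
      apply ENNReal.tendsto_ofReal_atTop.comp
      apply tendsto_neg_atBot_atTop.comp
      exact Real.tendsto_log_nhdsGT_zero.comp tendsto_norm_nhdsNE_zero
    refine h1.congr' ?_
    filter_upwards [self_mem_nhdsWithin] with x hx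
    rw [logU_of_ne hx]
  · have : ContinuousAt (fun c : ℂ => ENNReal.ofReal (-Real.log ‖c‖)) c := by
      apply ENNReal.continuous_ofReal.continuousAt.comp
      apply ContinuousAt.neg
      exact ContinuousAt.log continuous_norm.continuousAt (by simpa using hc)
    refine this.congr ?_
    filter_upwards [isOpen_ne.mem_nhds hc] with x hx
    rw [logU_of_ne hx]

lemma jensen' {g : ℂ → ℂ} {R : ℝ} (hR : 0 < R) (hg : AnalyticOnNhd ℂ g (closedBall 0 R)) :
    Real.circleAverage (fun z => Real.log ‖g z‖) 0 R =
      ∑ᶠ u, (MeromorphicOn.divisor g (closedBall 0 R) u : ℝ) * (Real.log R - Real.log ‖(0:ℂ) - u‖)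
      + Real.log ‖meromorphicTrailingCoeffAt g 0‖ := by
  have h := MeromorphicOn.circleAverage_log_norm (c := 0) (f := g) hR.ne'
    (by rw [abs_of_pos hR]; exact hg.meromorphicOn)
  rw [abs_of_pos hR] at h
  rw [h, countingFunction_finsum_eq_finsum_add hR.ne']
  exact (MeromorphicOn.divisor g (closedBall 0 R)).finiteSupport (isCompact_closedBall 0 R)

lemma circleAverage_mono_radius {g : ℂ → ℂ} {r R : ℝ} (hr : 0 < r) (hrR : r ≤ R)
    (hg : AnalyticOnNhd ℂ g (closedBall 0 R)) :
    Real.circleAverage (fun z => Real.log ‖g z‖) 0 r ≤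
      Real.circleAverage (fun z => Real.log ‖g z‖) 0 R := by
  have hsub : closedBall (0:ℂ) r ⊆ closedBall 0 R := closedBall_subset_closedBall hrR
  have hgr := hg.mono hsub
  rw [jensen' hr hgr, jensen' (hr.trans_le hrR) hg]
  have hfr := (MeromorphicOn.divisor g (closedBall 0 r)).finiteSupport (isCompact_closedBall 0 r)
  have hfR := (MeromorphicOn.divisor g (closedBall 0 R)).finiteSupport (isCompact_closedBall 0 R)
  gcongr
  apply finsum_le_finsum'
  · exact hfr.subset (by intro u; simp +contextual)
  · exact hfR.subset (by intro u; simp +contextual)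
  · intro u
    have hnn : (0:ℝ) ≤ MeromorphicOn.divisor g (closedBall 0 R) u := by
      exact_mod_cast (MeromorphicOn.AnalyticOnNhd.divisor_nonneg hg) u
    by_cases hu : u ∈ closedBall (0:ℂ) r
    · have : MeromorphicOn.divisor g (closedBall 0 r) u = MeromorphicOn.divisor g (closedBall 0 R) u := by
        rw [MeromorphicOn.divisor_apply hgr.meromorphicOn hu,
          MeromorphicOn.divisor_apply hg.meromorphicOn (hsub hu)]
      simp only [this]
      gcongr
    · simp only [Function.locallyFinsuppWithin.apply_eq_zero_of_notMem _ hu, Int.cast_zero, zero_mul]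
      by_cases hu' : u ∈ closedBall (0:ℂ) R
      · apply mul_nonneg hnn
        simp at hu hu' ⊢
        apply Real.log_le_log (hr.trans hu) hu'
      · simp [Function.locallyFinsuppWithin.apply_eq_zero_of_notMem _ hu']

lemma le_circleAverage {g : ℂ → ℂ} {R : ℝ} (hR : 0 < R)
    (hg : AnalyticOnNhd ℂ g (closedBall 0 R)) (h0 : g 0 ≠ 0) :
    Real.log ‖g 0‖ ≤ Real.circleAverage (fun z => Real.log ‖g z‖) 0 R := by
  rw [jensen' hR hg, (hg 0 (by simp [hR.le])).meromorphicTrailingCoeffAt_of_ne_zero h0]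
  have : 0 ≤ ∑ᶠ u, (MeromorphicOn.divisor g (closedBall 0 R) u : ℝ) *
      (Real.log R - Real.log ‖(0:ℂ) - u‖) := by
    apply finsum_nonneg
    intro u
    have hnn : (0:ℝ) ≤ MeromorphicOn.divisor g (closedBall 0 R) u := by
      exact_mod_cast (MeromorphicOn.AnalyticOnNhd.divisor_nonneg hg) u
    by_cases hu' : u ∈ closedBall (0:ℂ) R
    · by_cases hu : u = 0
      · subst hu
        rw [MeromorphicOn.AnalyticOnNhd.divisor_apply hg (by simp [hR.le]),
          (hg 0 (by simp [hR.le])).analyticOrderAt_eq_zero.mpr h0]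
        simp
      apply mul_nonneg hnn
      simp at hu' ⊢
      apply Real.log_le_log (by simpa using hu) hu'
    · simp [Function.locallyFinsuppWithin.apply_eq_zero_of_notMem _ hu']
  linarith

lemma lintegral_circle {g : ℂ → ℂ} {r R : ℝ} (hr : 0 < r) (hrR : r ≤ R)
    (hg : AnalyticOnNhd ℂ g (closedBall 0 R)) (hb : ∀ z ∈ closedBall (0:ℂ) R, ‖g z‖ ≤ 1)
    (hne : ∀ᶠ x in codiscreteWithin (closedBall (0:ℂ) R), g x ≠ 0) :
    ∫⁻ θ in Ioc 0 (2 * Real.pi), logU (g (circleMap 0 r θ)) =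
      ENNReal.ofReal (-(2 * Real.pi * Real.circleAverage (fun z => Real.log ‖g z‖) 0 r)) := by
  have hsub : sphere (0:ℂ) |r| ⊆ closedBall 0 R := by
    rw [abs_of_pos hr]
    exact sphere_subset_closedBall.trans (closedBall_subset_closedBall hrR)
  have hmem : ∀ θ, circleMap 0 r θ ∈ closedBall (0:ℂ) R := fun θ => hsub (by simp)
  have hci : CircleIntegrable (fun z => Real.log ‖g z‖) 0 r :=
    ((hg.mono hsub).meromorphicOn).circleIntegrable_log_norm
  have hae : ∀ᵐ θ ∂(volume.restrict (Ioc 0 (2 * Real.pi))), g (circleMap 0 r θ) ≠ 0 := by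
    have h1 : {x | g x ≠ 0} ∈ codiscreteWithin (sphere (0:ℂ) |r|) := codiscreteWithin_mono hsub hne
    have h2 := circleMap_preimage_codiscrete hr.ne' h1
    have h3 := ae_restrict_le_codiscreteWithin (μ := volume) measurableSet_Ioc
      (codiscreteWithin_mono (subset_univ (Ioc 0 (2 * Real.pi))) h2)
    exact h3
  have hpi : 0 < 2 * Real.pi := Real.two_pi_pos
  rw [Real.circleAverage_def, smul_eq_mul, mul_inv_cancel_left₀ hpi.ne',
    intervalIntegral.integral_of_le hpi.le, ← integral_neg]
  have hci' := (intervalIntegrable_iff_integrableOn_Ioc_of_le hpi.le).1 hci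
  rw [ofReal_integral_eq_lintegral_ofReal]
  · apply lintegral_congr_ae
    filter_upwards [hae] with θ hθ
    rw [logU_of_ne hθ]
  · exact hci'.neg
  · refine Eventually.of_forall fun θ => ?_
    have := Real.log_nonpos (norm_nonneg _) (hb _ (hmem θ))
    simp; linarith

lemma lintegral_circle_mono {g : ℂ → ℂ} {r : ℝ} (hr : 0 ≤ r) (hr1 : r ≤ 1)
    (hg : AnalyticOnNhd ℂ g (closedBall 0 1)) (hb : ∀ z ∈ closedBall (0:ℂ) 1, ‖g z‖ ≤ 1) :
    ∫⁻ θ in Ioc 0 (2 * Real.pi), logU (g (circleMap 0 1 θ)) ≤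
    ∫⁻ θ in Ioc 0 (2 * Real.pi), logU (g (circleMap 0 r θ)) := by
  have hpi : 0 < 2 * Real.pi := Real.two_pi_pos
  have hmem : ∀ s, 0 ≤ s → s ≤ 1 → ∀ θ, circleMap 0 s θ ∈ closedBall (0:ℂ) 1 := by
    intro s h0 h1 θ
    simp [abs_of_nonneg h0, h1]
  rcases hg.eqOn_zero_or_eventually_ne_zero_of_preconnected
    (convex_closedBall (0:ℂ) 1).isPreconnected with h | h
  · apply le_of_eq
    congr 1
    ext θ
    rw [h (hmem 1 zero_le_one le_rfl θ), h (hmem r hr hr1 θ)]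
    rfl
  rcases hr.eq_or_lt with rfl | hr
  · by_cases h0 : g 0 = 0
    · have hp : (2 * ENNReal.ofReal Real.pi) ≠ 0 := by simp [Real.pi_pos]
      simp [circleMap_zero_radius, h0, logU_zero, ENNReal.top_mul hp]
    · rw [lintegral_circle one_pos le_rfl hg hb h]
      simp only [circleMap_zero_radius, Function.const_apply, lintegral_const,
        Measure.restrict_apply_univ, Real.volume_Ioc, sub_zero]
      rw [logU_of_ne h0, ← ENNReal.ofReal_mul' hpi.le]
      apply ENNReal.ofReal_le_ofReal
      have := le_circleAverage one_pos hg h0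
      nlinarith
  · rw [lintegral_circle one_pos le_rfl hg hb h, lintegral_circle hr hr1 hg hb h]
    apply ENNReal.ofReal_le_ofReal
    have := circleAverage_mono_radius hr hr1 hg
    nlinarith

section
variable {E : Type*} [NormedAddCommGroup E] [NormedSpace ℂ E] [MeasurableSpace E] [BorelSpace E]
  [SecondCountableTopology E]

lemma ball_mono (μ : Measure E) [SFinite μ]
    (hrot : ∀ c : ℂ, ‖c‖ = 1 → MeasurePreserving (fun z : E => c • z) μ μ)
    {f : E → ℂ} {a : E} {R : ℝ} (hf : ∀ z ∈ closedBall a R, AnalyticAt ℂ f z)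
    (hb : ∀ z ∈ closedBall a R, ‖f z‖ ≤ 1) {r : ℝ} (hr : 0 ≤ r) (hr1 : r ≤ 1) :
    ∫⁻ z in closedBall 0 R, logU (f (a + z)) ∂μ ≤
      ∫⁻ z in closedBall 0 R, logU (f (a + (r : ℂ) • z)) ∂μ := by
  have hmem : ∀ w : ℂ, ‖w‖ ≤ 1 → ∀ z ∈ closedBall (0:E) R, a + w • z ∈ closedBall a R := by
    intro w hw z hz
    simp at hz ⊢
    rw [norm_smul]
    nlinarith [norm_nonneg z, norm_nonneg w]
  let F : ℝ → E → ℝ≥0∞ := fun s => (closedBall (0:E) R).indicator (fun z => logU (f (a + (s : ℂ) • z)))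
  have hFm : ∀ s, 0 ≤ s → s ≤ 1 → Measurable (F s) := by
    intro s h0 h1
    have hc : ContinuousOn (fun z => logU (f (a + (s : ℂ) • z))) (closedBall (0:E) R) := by
      apply continuous_logU.comp_continuousOn
      intro z hz
      have h2 := (hf _ (hmem s (by simp [abs_of_nonneg h0, h1]) z hz)).continuousAt
      have h3 : ContinuousAt (fun z : E => a + (s : ℂ) • z) z := by fun_prop
      exact (ContinuousAt.comp (g := f) (f := fun z : E => a + (s : ℂ) • z) h2 h3).continuousWithinAt
    classical
    have := hc.measurable_piecewise (g := fun _ => 0) continuousOn_const measurableSet_closedBall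
    have e : F s = (closedBall (0:E) R).piecewise (fun z => logU (f (a + (s : ℂ) • z))) (fun _ => 0) :=
      Set.piecewise_eq_indicator.symm
    rw [e]
    exact this
  have key : ∀ s, 0 ≤ s → s ≤ 1 → ENNReal.ofReal (2 * Real.pi) * ∫⁻ z, F s z ∂μ =
      ∫⁻ z in closedBall 0 R, (∫⁻ θ in Ioc 0 (2 * Real.pi),
        logU (f (a + circleMap 0 s θ • z))) ∂μ := by
    intro s h0 h1
    have e1 : ∀ θ : ℝ, ∫⁻ z, F s (circleMap 0 1 θ • z) ∂μ = ∫⁻ z, F s z ∂μ := fun θ =>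
      (hrot (circleMap 0 1 θ) (by simp)).lintegral_comp (hFm s h0 h1)
    have e2 : ∫⁻ θ in Ioc 0 (2 * Real.pi), ∫⁻ z, F s (circleMap 0 1 θ • z) ∂μ =
        ENNReal.ofReal (2 * Real.pi) * ∫⁻ z, F s z ∂μ := by
      simp_rw [e1]
      rw [lintegral_const, mul_comm]; simp
    rw [← e2, lintegral_lintegral_swap]
    · rw [← lintegral_indicator measurableSet_closedBall]
      congr 1
      ext z
      by_cases hz : z ∈ closedBall (0:E) R
      · rw [indicator_of_mem hz]
        congr 1
        ext θ
        have : circleMap 0 1 θ • z ∈ closedBall (0:E) R := by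
          simpa [norm_smul] using hz
        simp only [F]
        rw [indicator_of_mem this, smul_smul]
        simp [circleMap]
      · rw [indicator_of_notMem hz]
        have : ∀ θ, F s (circleMap 0 1 θ • z) = 0 := by
          intro θ
          apply indicator_of_notMem
          simpa [norm_smul] using hz
        simp [this]
    · apply Measurable.aemeasurable
      apply (hFm s h0 h1).comp
      apply Continuous.measurable
      apply Continuous.smul
      · exact (continuous_circleMap 0 1).comp continuous_fst
      · exact continuous_snd
  have hpi : 0 < 2 * Real.pi := Real.two_pi_pos
  have hfin : ∫⁻ z, F 1 z ∂μ ≤ ∫⁻ z, F r z ∂μ := by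
    rw [← ENNReal.mul_le_mul_iff_right (a := ENNReal.ofReal (2 * Real.pi)) (by simp [Real.pi_pos]) ENNReal.ofReal_ne_top,
      key 1 zero_le_one le_rfl, key r hr hr1]
    apply setLIntegral_mono' measurableSet_closedBall
    intro z hz
    apply lintegral_circle_mono (g := fun w => f (a + w • z)) hr hr1
    · intro w hw
      have h2 := hf _ (hmem w (by simpa using hw) z hz)
      have h3 : AnalyticAt ℂ (fun w : ℂ => a + w • z) w := by fun_prop
      exact AnalyticAt.comp (g := f) (f := fun w : ℂ => a + w • z) h2 h3
    · intro w hw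
      exact hb _ (hmem w (by simpa using hw) z hz)
  simp only [F] at hfin
  rw [lintegral_indicator measurableSet_closedBall, lintegral_indicator measurableSet_closedBall] at hfin
  simpa using hfin

lemma sub_mean (μ : Measure E) [SFinite μ] [μ.IsAddLeftInvariant]
    (hrot : ∀ c : ℂ, ‖c‖ = 1 → MeasurePreserving (fun z : E => c • z) μ μ)
    {f : E → ℂ} {a : E} {R : ℝ} (hf : ∀ z ∈ closedBall a R, AnalyticAt ℂ f z)
    (hb : ∀ z ∈ closedBall a R, ‖f z‖ ≤ 1) :
    ∫⁻ z in closedBall a R, logU (f z) ∂μ ≤ μ (closedBall a R) * logU (f a) := by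
  have h := ball_mono μ hrot hf hb le_rfl zero_le_one
  have hp : (fun z => a + z) ⁻¹' closedBall a R = closedBall 0 R := by
    ext z; simp
  have hmp := measurePreserving_add_left μ a
  have he := (Homeomorph.addLeft a).measurableEmbedding
  have h1 := hmp.setLIntegral_comp_preimage_emb he (fun z => logU (f z)) (closedBall a R)
  have h2 := hmp.measure_preimage_emb he (closedBall a R)
  rw [hp] at h1 h2
  rw [← h1, ← h2]
  refine h.trans ?_
  simp [mul_comm]

lemma scale_le (μ : Measure E) [μ.IsAddHaarMeasure] [FiniteDimensional ℝ E]
    (hrot : ∀ c : ℂ, ‖c‖ = 1 → MeasurePreserving (fun z : E => c • z) μ μ)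
    {f : E → ℂ} (hf : ∀ z ∈ closedBall (0:E) 1, AnalyticAt ℂ f z)
    (hb : ∀ z ∈ closedBall (0:E) 1, ‖f z‖ ≤ 1) {r : ℝ} (hr : 0 < r) (hr1 : r ≤ 1) :
    ∫⁻ z in closedBall 0 1, logU (f z) ∂μ ≤
      ENNReal.ofReal ((r ^ Module.finrank ℝ E)⁻¹) * ∫⁻ z in closedBall 0 r, logU (f z) ∂μ := by
  have h := ball_mono μ hrot hf hb hr.le hr1
  simp only [zero_add] at h
  refine h.trans (le_of_eq ?_)
  have hm := Measure.map_addHaar_smul μ hr.ne'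
  have he : MeasurableEmbedding (fun z : E => r • z) := (Homeomorph.smulOfNeZero r hr.ne').measurableEmbedding
  have hp : (fun z : E => r • z) ⁻¹' closedBall 0 r = closedBall 0 1 := by
    ext z
    simp [norm_smul, abs_of_pos hr, hr]
  have h1 := he.restrict_map μ (closedBall 0 r)
  rw [hp] at h1
  have h2 := he.lintegral_map (μ := μ.restrict (closedBall 0 1)) (fun z => logU (f z))
  rw [← h1] at h2
  have h3 : Measure.map (fun z : E => r • z) μ = _ := hm
  rw [h3, Measure.restrict_smul, lintegral_smul_measure] at h2
  rw [smul_eq_mul, abs_of_nonneg (by positivity)] at h2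
  rw [h2]
  simp [Complex.coe_smul]

end

section
variable {E : Type*} [NormedAddCommGroup E] [NormedSpace ℂ E] [MeasurableSpace E] [BorelSpace E]
  [FiniteDimensional ℝ E] [SecondCountableTopology E] [ProperSpace E]

lemma logU_aemeas (μ : Measure E) {f : E → ℂ} (hf : ∀ z ∈ closedBall (0:E) 1, AnalyticAt ℂ f z)
    {s : Set E} (hs : s ⊆ closedBall 0 1) (hsm : MeasurableSet s) :
    AEMeasurable (fun z => logU (f z)) (μ.restrict s) := by
  apply ContinuousOn.aemeasurable _ hsm
  apply continuous_logU.comp_continuousOn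
  intro z hz
  exact (hf z (hs hz)).continuousAt.continuousWithinAt

lemma finite_inner (μ : Measure E) [μ.IsAddHaarMeasure]
    (hrot : ∀ c : ℂ, ‖c‖ = 1 → MeasurePreserving (fun z : E => c • z) μ μ)
    {f : E → ℂ} (hf : ∀ z ∈ closedBall (0:E) 1, AnalyticAt ℂ f z)
    (hb : ∀ z ∈ closedBall (0:E) 1, ‖f z‖ ≤ 1) (hne : ∃ z ∈ closedBall (0:E) 1, f z ≠ 0)
    {r : ℝ} (hr1 : r < 1) :
    ∫⁻ z in closedBall 0 r, logU (f z) ∂μ < ⊤ := by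
  apply (isCompact_closedBall (0:E) r).induction_on
    (p := fun s => ∫⁻ z in s, logU (f z) ∂μ < ⊤)
  · simp
  · intro s t hst ht
    exact (lintegral_mono_set hst).trans_lt ht
  · intro s t hs ht
    exact (lintegral_union_le _ s t).trans_lt (ENNReal.add_lt_top.2 ⟨hs, ht⟩)
  · intro x hx
    have hx' : ‖x‖ ≤ r := by simpa using hx
    set ε := (1 - r) / 4 with hε
    have hεp : 0 < ε := by rw [hε]; linarith
    obtain ⟨a, ha, hfa⟩ : ∃ a ∈ ball x ε, f a ≠ 0 := by
      by_contra! hcon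
      obtain ⟨z, hz, hfz⟩ := hne
      apply hfz
      have hA : AnalyticOnNhd ℂ f (closedBall (0:E) 1) := hf
      refine hA.eqOn_zero_of_preconnected_of_eventuallyEq_zero
        (convex_closedBall (0:E) 1).isPreconnected (z₀ := x) (by simp; linarith) ?_ hz
      filter_upwards [ball_mem_nhds x hεp] with y hy
      exact hcon y hy
    have hsub : closedBall a (2 * ε) ⊆ closedBall (0:E) 1 := by
      intro y hy
      simp only [mem_closedBall, mem_ball, dist_zero_right] at *
      have h1 : ‖y‖ ≤ dist y a + dist a x + ‖x‖ := by
        have := dist_triangle4 y a x 0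
        simpa using this
      linarith
    refine ⟨closedBall a (2 * ε), mem_nhdsWithin_of_mem_nhds ?_, ?_⟩
    · apply closedBall_mem_nhds_of_mem
      rw [mem_ball, dist_comm]
      rw [mem_ball] at ha
      linarith
    · refine (sub_mean μ hrot (fun z hz => hf z (hsub hz)) (fun z hz => hb z (hsub hz))).trans_lt ?_
      rw [logU_of_ne hfa]
      exact ENNReal.mul_lt_top measure_closedBall_lt_top ENNReal.ofReal_lt_top

lemma small_nbhd (μ : Measure E) [μ.IsAddHaarMeasure]
    (hrot : ∀ c : ℂ, ‖c‖ = 1 → MeasurePreserving (fun z : E => c • z) μ μ)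
    {f : E → ℂ} (hf : ∀ z ∈ closedBall (0:E) 1, AnalyticAt ℂ f z)
    (hb : ∀ z ∈ closedBall (0:E) 1, ‖f z‖ ≤ 1) (hne : ∃ z ∈ closedBall (0:E) 1, f z ≠ 0)
    {F : ℕ → E → ℂ} (hF : ∀ i, ∀ z ∈ closedBall (0:E) 1, AnalyticAt ℂ (F i) z)
    (hFb : ∀ i, ∀ z ∈ closedBall (0:E) 1, ‖F i z‖ ≤ 1)
    (hlim : ∀ z ∈ closedBall (0:E) 1, Tendsto (fun i => F i z) atTop (𝓝 (f z)))
    {r : ℝ} (hr1 : r < 1) {ε : ℝ≥0∞} (hε : 0 < ε) :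
    ∃ W : Set E, IsOpen W ∧ closedBall 0 r ∩ {z | f z = 0} ⊆ W ∧
      ∀ᶠ i in atTop, ∫⁻ z in W, logU (F i z) ∂μ ≤ ε := by
  set Z := closedBall (0:E) r ∩ {z | f z = 0} with hZ
  set η := (1 - r) / 2 with hη
  have hηp : 0 < η := by rw [hη]; linarith
  set K' := closedBall (0:E) (r + η) with hK'
  have hKs : closedBall (0:E) r ⊆ closedBall 0 1 := closedBall_subset_closedBall hr1.le
  have hK's : K' ⊆ closedBall 0 1 := closedBall_subset_closedBall (by linarith)
  have hKK' : closedBall (0:E) r ⊆ K' := closedBall_subset_closedBall (by linarith)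
  have hfc : ContinuousOn f (closedBall 0 1) := fun z hz => (hf z hz).continuousAt.continuousWithinAt
  have hZcl : IsClosed Z := (hfc.mono hKs).preimage_isClosed_of_isClosed isClosed_closedBall
    (isClosed_singleton (x := (0:ℂ)))
  have hZc : IsCompact Z := (isCompact_closedBall (0:E) r).of_isClosed_subset hZcl inter_subset_left
  have hfin : ∫⁻ z in K', logU (f z) ∂μ < ⊤ := finite_inner μ hrot hf hb hne (by linarith)
  have hZ0 : μ Z = 0 := by
    have h1 := measure_eq_top_of_lintegral_ne_top (logU_aemeas μ hf hK's measurableSet_closedBall)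
      hfin.ne
    rw [Measure.restrict_apply' measurableSet_closedBall] at h1
    refine measure_mono_null ?_ h1
    intro z hz
    refine ⟨?_, hKK' hz.1⟩
    have : f z = 0 := hz.2
    simp [this, logU_zero]
  set C := ENNReal.ofReal (6 ^ Module.finrank ℝ E) with hC
  have hC0 : C ≠ 0 := by
    rw [hC]; simp
  have hCt : C ≠ ⊤ := ENNReal.ofReal_ne_top
  have hεC : ε / C ≠ 0 := (ENNReal.div_pos hε.ne' hCt).ne'
  obtain ⟨δ, hδ, hδs⟩ := exists_pos_setLIntegral_lt_of_measure_lt hfin.ne hεC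
  have hth := tendsto_measure_cthickening_of_isCompact (μ := μ) hZc
  rw [hZ0] at hth
  have hev : ∀ᶠ ρ in 𝓝[>] (0:ℝ), μ (cthickening ρ Z) < δ ∧ ρ < η / 7 ∧ 0 < ρ := by
    refine Filter.Eventually.and ?_ (Filter.Eventually.and ?_ self_mem_nhdsWithin)
    · exact (hth.eventually_lt_const hδ).filter_mono nhdsWithin_le_nhds
    · exact (eventually_lt_nhds (by positivity)).filter_mono nhdsWithin_le_nhds
  obtain ⟨ρ, hρδ, hρη, hρ⟩ := hev.exists
  obtain ⟨t, htZ, htf, htc⟩ := hZc.finite_cover_balls hρ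
  obtain ⟨v, hvt, hvd, hvc⟩ := Vitali.exists_disjoint_subfamily_covering_enlargement_closedBall
    t (fun x => x) (fun _ => ρ) ρ (fun _ _ => le_rfl) 5 (by norm_num)
  have hvf : v.Finite := htf.subset hvt
  have hnorm : ∀ b ∈ v, ‖b‖ ≤ r := fun b hb => by simpa using (htZ (hvt hb)).1
  have hbK : ∀ b ∈ v, closedBall b ρ ⊆ K' := by
    intro b hbv y hy
    have := hnorm b hbv
    rw [hK']
    simp only [mem_closedBall, dist_zero_right] at hy ⊢
    have h1 := dist_triangle y b 0
    simp only [dist_zero_right] at h1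
    linarith
  have hch : ∀ b : v, ∃ a ∈ closedBall (b : E) ρ,
      logU (f a) * μ (closedBall (b:E) ρ) ≤ ∫⁻ z in closedBall (b:E) ρ, logU (f z) ∂μ := by
    intro b
    have hp : μ (closedBall (b:E) ρ) ≠ 0 := (measure_closedBall_pos μ _ hρ).ne'
    have hq : μ (closedBall (b:E) ρ) ≠ ⊤ := measure_closedBall_lt_top.ne
    obtain ⟨a, ha, hle⟩ := exists_le_setLAverage (f := fun z => logU (f z)) hp hq
      (logU_aemeas μ hf ((hbK b b.2).trans hK's) measurableSet_closedBall)
    refine ⟨a, ha, ?_⟩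
    rw [setLAverage_eq] at hle
    rwa [← ENNReal.le_div_iff_mul_le (Or.inl hp) (Or.inl hq)]
  choose a ha hale using hch
  haveI : Fintype v := hvf.fintype
  have haB : ∀ b : v, closedBall (a b) (6 * ρ) ⊆ closedBall (0:E) 1 := by
    intro b y hy
    have h1 := ha b
    have h2 := hnorm b b.2
    simp only [mem_closedBall, dist_zero_right] at *
    have h3 := dist_triangle4 y (a b) b 0
    simp only [dist_zero_right] at h3
    linarith
  have hball : ∀ b : v, μ (closedBall (a b) (6 * ρ)) = C * μ (closedBall (b:E) ρ) := by
    intro b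
    rw [Measure.addHaar_closedBall_mul_of_pos μ _ (by norm_num : (0:ℝ) < 6),
      Measure.addHaar_closedBall_center μ (b:E)]
  refine ⟨⋃ x ∈ t, ball x ρ, isOpen_biUnion fun _ _ => isOpen_ball, htc, ?_⟩
  have hWle : ∀ i, ∫⁻ z in ⋃ x ∈ t, ball x ρ, logU (F i z) ∂μ ≤
      ∑ b : v, μ (closedBall (a b) (6 * ρ)) * logU (F i (a b)) := by
    intro i
    have hsub : (⋃ x ∈ t, ball x ρ) ⊆ ⋃ b : v, closedBall (a b) (6 * ρ) := by
      intro y hy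
      simp only [mem_iUnion] at hy
      obtain ⟨x, hx, hy⟩ := hy
      obtain ⟨b, hbv, hbs⟩ := hvc x hx
      have h1 := hbs (ball_subset_closedBall hy)
      simp only [mem_iUnion]
      refine ⟨⟨b, hbv⟩, ?_⟩
      have h2 := ha ⟨b, hbv⟩
      simp only [mem_closedBall] at h1 h2 ⊢
      have h3 := dist_triangle_right y (a ⟨b, hbv⟩) b
      linarith
    calc _ ≤ ∫⁻ z in ⋃ b : v, closedBall (a b) (6 * ρ), logU (F i z) ∂μ := lintegral_mono_set hsub
      _ ≤ ∑' b : v, ∫⁻ z in closedBall (a b) (6 * ρ), logU (F i z) ∂μ := lintegral_iUnion_le _ _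
      _ = ∑ b : v, ∫⁻ z in closedBall (a b) (6 * ρ), logU (F i z) ∂μ := tsum_fintype _
      _ ≤ _ := by
        apply Finset.sum_le_sum
        intro b _
        exact sub_mean μ hrot (fun z hz => hF i z (haB b hz)) (fun z hz => hFb i z (haB b hz))
  have htend : Tendsto (fun i => ∑ b : v, μ (closedBall (a b) (6 * ρ)) * logU (F i (a b))) atTop
      (𝓝 (∑ b : v, μ (closedBall (a b) (6 * ρ)) * logU (f (a b)))) := by
    apply tendsto_finsetSum
    intro b _
    apply ENNReal.Tendsto.const_mul
    · exact (continuous_logU.tendsto _).comp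
        (hlim _ (haB b (mem_closedBall_self (by positivity))))
    · right; exact measure_closedBall_lt_top.ne
  have hlt : ∑ b : v, μ (closedBall (a b) (6 * ρ)) * logU (f (a b)) < ε := by
    calc _ ≤ ∑ b : v, C * ∫⁻ z in closedBall (b:E) ρ, logU (f z) ∂μ := by
          apply Finset.sum_le_sum
          intro b _
          rw [hball, mul_assoc]
          gcongr
          rw [mul_comm]
          exact hale b
      _ = C * ∫⁻ z in ⋃ b : v, closedBall (b:E) ρ, logU (f z) ∂μ := by
          rw [← Finset.mul_sum, lintegral_iUnion (fun _ => measurableSet_closedBall), tsum_fintype]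
          intro b c hbc
          exact hvd b.2 c.2 (fun h => hbc (Subtype.ext h))
      _ ≤ C * ∫⁻ z in cthickening ρ Z, logU (f z) ∂(μ.restrict K') := by
          rw [Measure.restrict_restrict isClosed_cthickening.measurableSet]
          apply mul_le_mul' le_rfl
          apply lintegral_mono_set
          apply iUnion_subset
          intro b
          exact subset_inter (closedBall_subset_cthickening (htZ (hvt b.2)) ρ) (hbK b b.2)
      _ < C * (ε / C) := by
          rw [ENNReal.mul_lt_mul_iff_right hC0 hCt]
          exact hδs _ ((Measure.restrict_apply_le _ _).trans_lt hρδ)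
      _ = ε := ENNReal.mul_div_cancel hC0 hCt
  filter_upwards [htend.eventually_lt_const hlt] with i hi
  exact (hWle i).trans hi.le

lemma inner_limsup (μ : Measure E) [μ.IsAddHaarMeasure]
    (hrot : ∀ c : ℂ, ‖c‖ = 1 → MeasurePreserving (fun z : E => c • z) μ μ)
    {f : E → ℂ} (hf : ∀ z ∈ closedBall (0:E) 1, AnalyticAt ℂ f z)
    (hb : ∀ z ∈ closedBall (0:E) 1, ‖f z‖ ≤ 1) (hne : ∃ z ∈ closedBall (0:E) 1, f z ≠ 0)
    {F : ℕ → E → ℂ} (hF : ∀ i, ∀ z ∈ closedBall (0:E) 1, AnalyticAt ℂ (F i) z)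
    (hFb : ∀ i, ∀ z ∈ closedBall (0:E) 1, ‖F i z‖ ≤ 1)
    (hconv : TendstoUniformlyOn F f atTop (closedBall (0:E) 1))
    {r : ℝ} (hr1 : r < 1) {ε : ℝ≥0∞} (hε : 0 < ε) :
    ∀ᶠ i in atTop, ∫⁻ z in closedBall 0 r, logU (F i z) ∂μ ≤
      ∫⁻ z in closedBall 0 r, logU (f z) ∂μ + ε := by
  have hlim : ∀ z ∈ closedBall (0:E) 1, Tendsto (fun i => F i z) atTop (𝓝 (f z)) :=
    fun z hz => hconv.tendsto_at hz
  have hε2 : 0 < ε / 2 := ENNReal.div_pos hε.ne' (by simp)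
  obtain ⟨W, hWo, hWZ, hW⟩ := small_nbhd μ hrot hf hb hne hF hFb hlim hr1 hε2
  set L := closedBall (0:E) r \ W with hL
  have hKs : closedBall (0:E) r ⊆ closedBall 0 1 := closedBall_subset_closedBall hr1.le
  have hLs : L ⊆ closedBall 0 1 := diff_subset.trans hKs
  have hLc : IsCompact L := (isCompact_closedBall (0:E) r).diff hWo
  have hLm : MeasurableSet L := hLc.measurableSet
  have hfc : ContinuousOn f (closedBall 0 1) := fun z hz => (hf z hz).continuousAt.continuousWithinAt
  obtain ⟨c, hc0, hc⟩ := hLc.exists_forall_le' (hfc.mono hLs).norm (a := 0) (by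
    intro z hz
    rw [norm_pos_iff]
    intro h0
    exact hz.2 (hWZ ⟨hz.1, h0⟩))
  have hunif := Metric.tendstoUniformlyOn_iff.1 hconv (c / 2) (by positivity)
  obtain ⟨N, hN⟩ := eventually_atTop.1 hunif
  have hdom : Tendsto (fun i => ∫⁻ z in L, logU (F (i + N) z) ∂μ) atTop
      (𝓝 (∫⁻ z in L, logU (f z) ∂μ)) := by
    apply tendsto_lintegral_of_dominated_convergence' (fun _ => ENNReal.ofReal (-Real.log (c / 2)))
    · intro i
      exact logU_aemeas μ (hF _) hLs hLm
    · intro i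
      filter_upwards [ae_restrict_mem hLm] with z hz
      have h1 := hN (i + N) (by omega) z (hLs hz)
      have h2 := hc z hz
      have h3 : c / 2 ≤ ‖F (i + N) z‖ := by
        rw [dist_eq_norm] at h1
        have := norm_sub_norm_le (f z) (F (i + N) z)
        linarith
      have h4 : F (i + N) z ≠ 0 := by
        rw [← norm_pos_iff]; linarith
      rw [logU_of_ne h4]
      apply ENNReal.ofReal_le_ofReal
      apply neg_le_neg
      exact Real.log_le_log (by positivity) h3
    · rw [lintegral_const]
      apply ENNReal.mul_ne_top ENNReal.ofReal_ne_top
      simp [hLc.measure_lt_top.ne]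
    · filter_upwards [ae_restrict_mem hLm] with z hz
      exact ((continuous_logU.tendsto _).comp (hlim z (hLs hz))).comp (tendsto_add_atTop_nat N)
  rw [tendsto_add_atTop_iff_nat (f := fun i => ∫⁻ z in L, logU (F i z) ∂μ)] at hdom
  have hLfin : ∫⁻ z in L, logU (f z) ∂μ < ⊤ :=
    (lintegral_mono_set diff_subset).trans_lt (finite_inner μ hrot hf hb hne hr1)
  have hev := hdom.eventually_lt_const (ENNReal.lt_add_right hLfin.ne hε2.ne')
  filter_upwards [hW, hev] with i h1 h2
  calc ∫⁻ z in closedBall 0 r, logU (F i z) ∂μ ≤ ∫⁻ z in L ∪ W, logU (F i z) ∂μ := by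
        apply lintegral_mono_set
        rw [hL, diff_union_self]
        exact subset_union_left
    _ ≤ _ := lintegral_union_le _ _ _
    _ ≤ (∫⁻ z in L, logU (f z) ∂μ + ε / 2) + ε / 2 := by gcongr
    _ = ∫⁻ z in L, logU (f z) ∂μ + ε := by rw [add_assoc, ENNReal.add_halves]
    _ ≤ _ := by
      gcongr
      exact diff_subset

lemma main_tendsto (μ : Measure E) [μ.IsAddHaarMeasure]
    (hrot : ∀ c : ℂ, ‖c‖ = 1 → MeasurePreserving (fun z : E => c • z) μ μ)
    {f : E → ℂ} (hf : ∀ z ∈ closedBall (0:E) 1, AnalyticAt ℂ f z)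
    (hb : ∀ z ∈ closedBall (0:E) 1, ‖f z‖ ≤ 1) (hne : ∃ z ∈ closedBall (0:E) 1, f z ≠ 0)
    {F : ℕ → E → ℂ} (hF : ∀ i, ∀ z ∈ closedBall (0:E) 1, AnalyticAt ℂ (F i) z)
    (hFb : ∀ i, ∀ z ∈ closedBall (0:E) 1, ‖F i z‖ ≤ 1)
    (hconv : TendstoUniformlyOn F f atTop (closedBall (0:E) 1)) :
    ∫⁻ z in closedBall 0 1, logU (f z) ∂μ < ⊤ ∧
    Tendsto (fun i => ∫⁻ z in closedBall 0 1, logU (F i z) ∂μ) atTop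
      (𝓝 (∫⁻ z in closedBall 0 1, logU (f z) ∂μ)) := by
  have hfin : ∫⁻ z in closedBall 0 1, logU (f z) ∂μ < ⊤ := by
    refine (scale_le μ hrot hf hb (r := 1 / 2) (by norm_num) (by norm_num)).trans_lt ?_
    exact ENNReal.mul_lt_top ENNReal.ofReal_lt_top
      (finite_inner μ hrot hf hb hne (by norm_num))
  refine ⟨hfin, ?_⟩
  set I := ∫⁻ z in closedBall 0 1, logU (f z) ∂μ with hI
  rw [tendsto_order]
  constructor
  · intro s hs
    refine eventually_lt_of_lt_liminf (hs.trans_le ?_)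
    refine le_trans ?_ (lintegral_liminf_le' (fun i => logU_aemeas μ (hF i) Subset.rfl
      measurableSet_closedBall))
    apply le_of_eq
    apply setLIntegral_congr_fun measurableSet_closedBall
    intro z hz
    exact ((continuous_logU.tendsto _).comp (hconv.tendsto_at hz)).liminf_eq.symm
  · intro t ht
    have hcont : Tendsto (fun r : ℝ => ENNReal.ofReal ((r ^ Module.finrank ℝ E)⁻¹) *
        (I + ENNReal.ofReal (1 - r))) (𝓝[<] 1) (𝓝 (ENNReal.ofReal (((1:ℝ) ^ Module.finrank ℝ E)⁻¹) *
        (I + ENNReal.ofReal (1 - 1)))) := by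
      apply Tendsto.mono_left _ nhdsWithin_le_nhds
      apply ENNReal.Tendsto.mul
      · apply ENNReal.tendsto_ofReal
        apply Tendsto.inv₀ _ (by simp)
        exact (continuous_pow _).tendsto _
      · right; simpa using hfin.ne
      · apply Tendsto.const_add
        apply ENNReal.tendsto_ofReal
        exact (continuous_const.sub continuous_id).tendsto _
      · right; exact ENNReal.ofReal_ne_top
    have hval : ENNReal.ofReal (((1:ℝ) ^ Module.finrank ℝ E)⁻¹) * (I + ENNReal.ofReal (1 - 1)) < t := by
      simpa using ht
    obtain ⟨r, hrt, hr1, hr0⟩ := ((hcont.eventually_lt_const hval).and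
      ((show ∀ᶠ r in 𝓝[<] (1:ℝ), r < 1 from self_mem_nhdsWithin).and
        ((eventually_gt_nhds (zero_lt_one' ℝ)).filter_mono nhdsWithin_le_nhds))).exists
    filter_upwards [inner_limsup μ hrot hf hb hne hF hFb hconv hr1
      (ε := ENNReal.ofReal (1 - r)) (by simpa using hr1)] with i hi
    refine (scale_le μ hrot (hF i) (hFb i) hr0 hr1.le).trans_lt (lt_of_le_of_lt ?_ hrt)
    gcongr
    refine hi.trans ?_
    gcongr
    exact lintegral_mono_set (closedBall_subset_closedBall hr1.le)

end

section
lemma hausdorff_haar (n : ℕ) : (μH[(2*n : ℝ)] : Measure (EuclideanSpace ℂ (Fin n))).IsAddHaarMeasure := by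
  have h : Module.finrank ℝ (EuclideanSpace ℂ (Fin n)) = 2 * n := by
    rw [finrank_real_of_complex]; simp
  have h2 := MeasureTheory.isAddHaarMeasure_hausdorffMeasure (E := EuclideanSpace ℂ (Fin n))
  rw [h] at h2
  push_cast at h2
  exact h2

lemma hausdorff_rot (n : ℕ) (c : ℂ) (hc : ‖c‖ = 1) :
    MeasurePreserving (fun z : EuclideanSpace ℂ (Fin n) => c • z) μH[(2*n : ℝ)] μH[(2*n : ℝ)] := by
  have hc0 : c ≠ 0 := by rw [← norm_pos_iff, hc]; norm_num
  let e : EuclideanSpace ℂ (Fin n) ≃ᵢ EuclideanSpace ℂ (Fin n) :=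
    IsometryEquiv.mk' (fun z => c • z) (fun z => c⁻¹ • z) (fun z => smul_inv_smul₀ hc0 z)
      (Isometry.of_dist_eq fun x y => by rw [dist_smul₀, hc, one_mul])
  exact e.measurePreserving_hausdorffMeasure _

lemma integral_log_eq {E : Type*} [NormedAddCommGroup E] [NormedSpace ℂ E] [MeasurableSpace E]
    [BorelSpace E] [FiniteDimensional ℝ E] [SecondCountableTopology E] [ProperSpace E]
    (μ : Measure E) {f : E → ℂ} (hf : ∀ z ∈ closedBall (0:E) 1, AnalyticAt ℂ f z)
    (hb : ∀ z ∈ closedBall (0:E) 1, ‖f z‖ ≤ 1)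
    (hfin : ∫⁻ z in closedBall 0 1, logU (f z) ∂μ < ⊤) :
    ∫ z in closedBall (0:E) 1, Real.log ‖f z‖ ∂μ =
      -(∫⁻ z in closedBall 0 1, logU (f z) ∂μ).toReal := by
  have hm := logU_aemeas μ hf Subset.rfl measurableSet_closedBall
  rw [← integral_toReal hm (ae_lt_top' hm hfin.ne), ← integral_neg]
  apply setIntegral_congr_fun measurableSet_closedBall
  intro z hz
  simp [logU_toReal (hb z hz)]
end

end

/-- If holomorphic functions `f i` on a neighborhood of the closed unit
ball `B ⊂ ℂⁿ`, bounded by `1` there, converge uniformly on `B` to a holomorphic `f∞ ≢ 0`,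
then `∫_B log |f i| → ∫_B log |f∞|`; in particular the integrals `∫_B log |f i|` are
uniformly bounded. -/
theorem stmt18 (n : ℕ) (f : ℕ → EuclideanSpace ℂ (Fin n) → ℂ)
    (flim : EuclideanSpace ℂ (Fin n) → ℂ)
    (U : Set (EuclideanSpace ℂ (Fin n))) (hU : IsOpen U)
    (hBU : Metric.closedBall 0 1 ⊆ U)
    (hf : ∀ i, ∀ z ∈ U, AnalyticAt ℂ (f i) z)
    (hflim : ∀ z ∈ U, AnalyticAt ℂ flim z)
    (hne : ∃ z ∈ Metric.closedBall (0 : EuclideanSpace ℂ (Fin n)) 1, flim z ≠ 0)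
    (hbd : ∀ i, ∀ z ∈ Metric.closedBall (0 : EuclideanSpace ℂ (Fin n)) 1, ‖f i z‖ ≤ 1)
    (hconv : TendstoUniformlyOn f flim Filter.atTop
      (Metric.closedBall (0 : EuclideanSpace ℂ (Fin n)) 1)) :
    Filter.Tendsto
      (fun i => ∫ z in Metric.closedBall (0 : EuclideanSpace ℂ (Fin n)) 1,
        Real.log ‖f i z‖ ∂ μH[(2*n : ℝ)])
      Filter.atTop
      (nhds (∫ z in Metric.closedBall (0 : EuclideanSpace ℂ (Fin n)) 1,
        Real.log ‖flim z‖ ∂ μH[(2*n : ℝ)])) ∧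
    ∃ C : ℝ, ∀ i,
      |∫ z in Metric.closedBall (0 : EuclideanSpace ℂ (Fin n)) 1,
        Real.log ‖f i z‖ ∂ μH[(2*n : ℝ)]| ≤ C := by
  have := hausdorff_haar n
  have : FiniteDimensional ℝ (EuclideanSpace ℂ (Fin n)) := FiniteDimensional.complexToReal _
  have hblim : ∀ z ∈ Metric.closedBall (0 : EuclideanSpace ℂ (Fin n)) 1, ‖flim z‖ ≤ 1 :=
    fun z hz => le_of_tendsto (hconv.tendsto_at hz).norm (Filter.Eventually.of_forall fun i => hbd i z hz)
  have hf' : ∀ i, ∀ z ∈ Metric.closedBall (0 : EuclideanSpace ℂ (Fin n)) 1, AnalyticAt ℂ (f i) z :=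
    fun i z hz => hf i z (hBU hz)
  have hfl' : ∀ z ∈ Metric.closedBall (0 : EuclideanSpace ℂ (Fin n)) 1, AnalyticAt ℂ flim z :=
    fun z hz => hflim z (hBU hz)
  obtain ⟨hfin, ht⟩ := main_tendsto μH[(2*n : ℝ)] (hausdorff_rot n) hfl' hblim hne hf' hbd hconv
  have key : Filter.Tendsto
      (fun i => ∫ z in Metric.closedBall (0 : EuclideanSpace ℂ (Fin n)) 1,
        Real.log ‖f i z‖ ∂ μH[(2*n : ℝ)])
      Filter.atTop
      (nhds (∫ z in Metric.closedBall (0 : EuclideanSpace ℂ (Fin n)) 1,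
        Real.log ‖flim z‖ ∂ μH[(2*n : ℝ)])) := by
    rw [integral_log_eq _ hfl' hblim hfin]
    refine (((ENNReal.tendsto_toReal hfin.ne).comp ht).neg).congr' ?_
    filter_upwards [ht.eventually_lt_const hfin] with i hi
    exact (integral_log_eq _ (hf' i) (hbd i) hi).symm
  refine ⟨key, ?_⟩
  obtain ⟨C, hC⟩ := (key.abs).bddAbove_range
  exact ⟨C, fun i => hC ⟨i, rfl⟩⟩
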